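/- Let G and G' be groups and n ≥ 0, and suppose G is abstractly commensurable with the direct product G' × ℤ^n. Then G is abstractly commensurable with the right-angled Artin group of some finite simple graph if and only if G' is abstractly commensurable with the right-angled Artin group of some finite simple graph. -/

import Mathlib

/-- The defining relators of the right-angled Artin group on the simple graph `Γ`:
one commutator relator for each edge of `Γ`. -/
def raagRels {V : Type*} (Γ : SimpleGraph V) : Set (FreeGroup V) :=
  {r : FreeGroup V | ∃ u w : V, Γ.Adj u w ∧
    r = FreeGroup.of u * FreeGroup.of w * (FreeGroup.of u)⁻¹ * (FreeGroup.of w)⁻¹}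

/-- The right-angled Artin group of a simple graph `Γ`: the presented group with one
generator for each vertex of `Γ` and a commutator relator for each edge of `Γ`. -/
abbrev RAAG {V : Type*} (Γ : SimpleGraph V) : Type _ :=
  PresentedGroup (raagRels Γ)

/-- Two groups are abstractly commensurable if they have isomorphic finite-index
subgroups. -/
def AbstractlyCommensurable (G H : Type*) [Group G] [Group H] : Prop :=
  ∃ (G' : Subgroup G) (H' : Subgroup H),
    G'.FiniteIndex ∧ H'.FiniteIndex ∧ Nonempty (G' ≃* H')

namespace AbstractlyCommensurable

/-- Homomorphisms out of a common group with the same kernel and with images of finite index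
exhibit their targets as abstractly commensurable. -/
theorem of_ker_eq {K G H : Type*} [Group K] [Group G] [Group H] (f : K →* G) (g : K →* H)
    (h : f.ker = g.ker) (hf : f.range.FiniteIndex) (hg : g.range.FiniteIndex) :
    AbstractlyCommensurable G H :=
  ⟨f.range, g.range, hf, hg,
    ⟨(QuotientGroup.quotientKerEquivRange f).symm.trans
      ((QuotientGroup.quotientMulEquivOfEq h).trans (QuotientGroup.quotientKerEquivRange g))⟩⟩

theorem of_injective {G H : Type*} [Group G] [Group H] (f : G →* H)
    (hf : Function.Injective f) (h : f.range.FiniteIndex) : AbstractlyCommensurable G H :=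
  of_ker_eq (MonoidHom.id G) f (by rw [(MonoidHom.ker_eq_bot_iff f).2 hf]; rfl)
    (by rw [MonoidHom.range_eq_top.2 (MulEquiv.refl G).surjective]; infer_instance) h

theorem of_mulEquiv {G H : Type*} [Group G] [Group H] (e : G ≃* H) :
    AbstractlyCommensurable G H :=
  of_injective e.toMonoidHom e.injective
    (by rw [MonoidHom.range_eq_top.2 e.surjective]; infer_instance)

theorem symm {G H : Type*} [Group G] [Group H] (h : AbstractlyCommensurable G H) :
    AbstractlyCommensurable H G := by
  obtain ⟨G₁, H₁, hG, hH, ⟨e⟩⟩ := h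
  exact ⟨H₁, G₁, hH, hG, ⟨e.symm⟩⟩

theorem trans {G H K : Type*} [Group G] [Group H] [Group K] (h₁ : AbstractlyCommensurable G H)
    (h₂ : AbstractlyCommensurable H K) : AbstractlyCommensurable G K := by
  obtain ⟨G₁, H₁, hG₁, hH₁, ⟨e⟩⟩ := h₁
  obtain ⟨H₂, K₂, hH₂, hK₂, ⟨e'⟩⟩ := h₂
  let f : (H₁ ⊓ H₂ : Subgroup H) →* G :=
    (G₁.subtype.comp e.symm.toMonoidHom).comp (Subgroup.inclusion inf_le_left)
  let g : (H₁ ⊓ H₂ : Subgroup H) →* K :=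
    (K₂.subtype.comp e'.toMonoidHom).comp (Subgroup.inclusion inf_le_right)
  have hf : Function.Injective f :=
    (Subtype.val_injective.comp e.symm.injective).comp (Subgroup.inclusion_injective _)
  have hg : Function.Injective g :=
    (Subtype.val_injective.comp e'.injective).comp (Subgroup.inclusion_injective _)
  refine of_ker_eq f g ?_ ?_ ?_
  · rw [(MonoidHom.ker_eq_bot_iff f).2 hf, (MonoidHom.ker_eq_bot_iff g).2 hg]
  · refine ⟨?_⟩
    rw [MonoidHom.range_comp, Subgroup.index_map_of_injective _
      (Subtype.val_injective.comp e.symm.injective), Subgroup.inclusion_range,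
      MonoidHom.range_comp, MonoidHom.range_eq_top.2 e.symm.surjective, ← MonoidHom.range_eq_map,
      Subgroup.range_subtype]
    exact mul_ne_zero Subgroup.FiniteIndex.index_ne_zero hG₁.index_ne_zero
  · refine ⟨?_⟩
    rw [MonoidHom.range_comp, Subgroup.index_map_of_injective _
      (Subtype.val_injective.comp e'.injective), Subgroup.inclusion_range,
      MonoidHom.range_comp, MonoidHom.range_eq_top.2 e'.surjective, ← MonoidHom.range_eq_map,
      Subgroup.range_subtype]
    exact mul_ne_zero Subgroup.FiniteIndex.index_ne_zero hK₂.index_ne_zero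

theorem _root_.Subgroup.FiniteIndex.prod {G H : Type*} [Group G] [Group H] {K : Subgroup G}
    {L : Subgroup H} (hK : K.FiniteIndex) (hL : L.FiniteIndex) : (K.prod L).FiniteIndex :=
  ⟨by rw [Subgroup.index_prod]; exact mul_ne_zero hK.index_ne_zero hL.index_ne_zero⟩

theorem prod {G H G' H' : Type*} [Group G] [Group H] [Group G'] [Group H']
    (h : AbstractlyCommensurable G H) (h' : AbstractlyCommensurable G' H') :
    AbstractlyCommensurable (G × G') (H × H') := by
  obtain ⟨G₁, H₁, hG, hH, ⟨e⟩⟩ := h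
  obtain ⟨G₂, H₂, hG', hH', ⟨e'⟩⟩ := h'
  exact ⟨G₁.prod G₂, H₁.prod H₂, hG.prod hG', hH.prod hH',
    ⟨(Subgroup.prodEquiv G₁ G₂).trans ((e.prodCongr e').trans (Subgroup.prodEquiv H₁ H₂).symm)⟩⟩

theorem refl (G : Type*) [Group G] : AbstractlyCommensurable G G :=
  of_mulEquiv (MulEquiv.refl G)

theorem prod_finite (G F : Type*) [Group G] [Group F] [Finite F] :
    AbstractlyCommensurable (G × F) G :=
  (of_injective (MonoidHom.inl G F) (fun a b h => congrArg Prod.fst h) (by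
    have : (MonoidHom.inl G F).range = (⊤ : Subgroup G).prod (⊥ : Subgroup F) := by
      ext ⟨a, b⟩
      simp [Subgroup.mem_prod, eq_comm]
    rw [this]
    exact Subgroup.FiniteIndex.prod inferInstance inferInstance)).symm

/-- Let every element of `B` centralizing a finite-index subgroup of `B` be trivial. If `B × T` is
abstractly commensurable with `G × N`, where `T` and `N` are abelian and `T` is finitely generated,
then `G` is abstractly commensurable with the product of `B` and a free abelian group. -/
theorem exists_prod_free_of_prod {B T G N : Type*} [Group B] [CommGroup T] [Group.FG T]
    [Group G] [CommGroup N]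
    (hB : ∀ (z : B) (K : Subgroup B), K.FiniteIndex → (∀ k ∈ K, Commute z k) → z = 1)
    (h : AbstractlyCommensurable (B × T) (G × N)) :
    ∃ (j : Type) (_ : Fintype j), AbstractlyCommensurable G (B × (j → Multiplicative ℤ)) := by
  obtain ⟨H, K, hH, hK, ⟨e⟩⟩ := h
  let ψ : H →* G := (MonoidHom.fst G N).comp (K.subtype.comp e.toMonoidHom)
  let L : Subgroup T := ψ.ker.map ((MonoidHom.snd B T).comp H.subtype)
  let θ : H →* B × (T ⧸ L) :=
    ((MonoidHom.id B).prodMap (QuotientGroup.mk' L)).comp H.subtype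
  have hfst : ∀ x ∈ ψ.ker, (x : B × T).1 = 1 := by
    intro x hx
    have hx1 : (e x : G × N).1 = 1 := hx
    refine hB _ (H.map (MonoidHom.fst B T)) ⟨?_⟩ ?_
    · exact ne_zero_of_dvd_ne_zero hH.index_ne_zero (H.index_map_dvd Prod.fst_surjective)
    · rintro _ ⟨y, hy, rfl⟩
      have hc : Commute x ⟨y, hy⟩ := by
        apply e.injective
        ext
        · simp [hx1]
        · simp [mul_comm]
      exact congrArg (fun z : H => (z : B × T).1) hc.eq
  have hker : ψ.ker = θ.ker := by
    ext x
    constructor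
    · intro hx
      refine Prod.ext (hfst x hx) ?_
      exact (QuotientGroup.eq_one_iff _).2 ⟨x, hx, rfl⟩
    · intro hx
      have h1 : (x : B × T).1 = 1 := congrArg Prod.fst (MonoidHom.mem_ker.1 hx)
      have h2 : QuotientGroup.mk' L (x : B × T).2 = 1 := congrArg Prod.snd (MonoidHom.mem_ker.1 hx)
      obtain ⟨y, hy, hyx⟩ := (QuotientGroup.eq_one_iff _).1 h2
      have : y = x := Subtype.ext (Prod.ext ((hfst y hy).trans h1.symm) hyx)
      exact this ▸ hy
  have hψ : ψ.range.FiniteIndex := by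
    refine ⟨?_⟩
    rw [MonoidHom.range_comp, MonoidHom.range_comp, MonoidHom.range_eq_top.2 e.surjective,
      ← MonoidHom.range_eq_map, Subgroup.range_subtype]
    exact ne_zero_of_dvd_ne_zero hK.index_ne_zero (K.index_map_dvd Prod.fst_surjective)
  have hθ : θ.range.FiniteIndex := by
    refine ⟨?_⟩
    rw [MonoidHom.range_comp, Subgroup.range_subtype]
    exact ne_zero_of_dvd_ne_zero hH.index_ne_zero (H.index_map_dvd
      (Function.Surjective.prodMap Function.surjective_id (QuotientGroup.mk'_surjective L)))
  obtain ⟨ι, j, hι, hj, p, hp, k, ⟨i⟩⟩ :=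
    CommGroup.equiv_free_prod_prod_multiplicative_zmod (T ⧸ L)
  have : ∀ a, NeZero (p a ^ k a) := fun a => ⟨pow_ne_zero _ (hp a).ne_zero⟩
  have : ∀ a, Finite (Multiplicative (ZMod (p a ^ k a))) := fun a =>
    inferInstanceAs (Finite (ZMod (p a ^ k a)))
  exact ⟨j, hj, (of_ker_eq ψ θ hker hψ hθ).trans
    ((refl B).prod ((of_mulEquiv i).trans (prod_finite _ _)))⟩

end AbstractlyCommensurable

namespace FreeGroup

variable {α : Type*}

theorem IsReduced.replicate_append {L : List (α × Bool)} {a : α} (hL : IsReduced L)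
    (h : ∀ x ∈ L.head?, x.1 ≠ a) (m : ℕ) : IsReduced (List.replicate m (a, true) ++ L) := by
  refine List.IsChain.append ?_ hL ?_
  · exact List.isChain_replicate_of_rel _ fun _ => rfl
  · intro x hx y hy hxy
    have hxa : x = (a, true) := by
      have := List.mem_of_mem_getLast? hx
      exact List.eq_of_mem_replicate this
    subst hxa
    exact absurd hxy.symm (h y hy)

/-- The centralizer of a nontrivial power of a free generator consists of powers of that
generator. -/
theorem mem_zpowers_of_commute_of_pow {a : α} {m : ℕ} (hm : m ≠ 0) (f : FreeGroup α)
    (hf : Commute f (of a ^ m)) : f ∈ Subgroup.zpowers (of a) := by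
  classical
  induction hn : f.norm using Nat.strong_induction_on generalizing f with
  | _ n ih =>
  rcases hw : f.toWord with _ | ⟨⟨c, b⟩, L⟩
  · rw [toWord_eq_nil_iff.1 hw]
    exact one_mem _
  by_cases hc : c = a
  · subst hc
    have hfL : f = mk [(c, b)] * mk L := by
      rw [mul_mk, ← mk_toWord (x := f), hw]
      rfl
    have hcb : mk [(c, b)] ∈ Subgroup.zpowers (of c) := by
      cases b
      · exact inv_mem (Subgroup.mem_zpowers (of c))
      · exact Subgroup.mem_zpowers (of c)
    have hcomm : Commute (mk [(c, b)]) (of c ^ m) := by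
      obtain ⟨k, hk⟩ := Subgroup.mem_zpowers_iff.1 hcb
      rw [← hk]
      exact ((Commute.refl _).zpow_left k).pow_right m
    rw [hfL]
    refine mul_mem hcb (ih (mk L).norm ?_ (mk L) ?_ rfl)
    · refine norm_mk_le.trans_lt ?_
      rw [← hn, norm, hw]
      simp
    · have : mk L = (mk [(c, b)])⁻¹ * f := by rw [hfL, inv_mul_cancel_left]
      rw [this]
      exact hcomm.inv_left.mul_left hf
  · exfalso
    have hred : (of a ^ m * f).toWord = List.replicate m (a, true) ++ f.toWord := by
      rw [toWord_mul, toWord_of_pow]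
      refine (IsReduced.replicate_append isReduced_toWord ?_ m).reduce_eq
      rw [hw]
      rintro x ⟨⟩
      exact hc
    have hsub := toWord_mul_sublist f (of a ^ m)
    rw [hf.eq, hred, toWord_of_pow] at hsub
    have heq := hsub.eq_of_length (by simp [add_comm])
    obtain ⟨k, rfl⟩ := Nat.exists_eq_succ_of_ne_zero hm
    rw [hw] at heq
    simp only [Nat.succ_eq_add_one, List.replicate_succ, List.cons_append, List.cons.injEq,
      Prod.mk.injEq] at heq
    exact hc heq.1.1.symm

end FreeGroup

namespace RAAG

variable {V : Type*} (Γ : SimpleGraph V)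

/-- The generator of a right-angled Artin group associated with a vertex. -/
abbrev of (v : V) : RAAG Γ := PresentedGroup.of v

variable {Γ}

theorem commute_of {u w : V} (h : Γ.Adj u w) : Commute (of Γ u) (of Γ w) := by
  have := PresentedGroup.one_of_mem (rels := raagRels Γ) ⟨u, w, h, rfl⟩
  simp only [map_mul, map_inv] at this
  rw [← commutatorElement_def, commutatorElement_eq_one_iff_commute] at this
  exact this

/-- A map from the vertices of a graph to a group that sends adjacent vertices to commuting
elements extends to the right-angled Artin group. -/
def lift {G : Type*} [Group G] (f : V → G) (h : ∀ u w, Γ.Adj u w → Commute (f u) (f w)) :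
    RAAG Γ →* G :=
  PresentedGroup.toGroup (f := f) (rels := raagRels Γ) (by
    rintro r ⟨u, w, huw, rfl⟩
    simp only [map_mul, map_inv, FreeGroup.lift_apply_of]
    rw [← commutatorElement_def, commutatorElement_eq_one_iff_commute]
    exact h u w huw)

@[simp]
theorem lift_of {G : Type*} [Group G] (f : V → G)
    (h : ∀ u w, Γ.Adj u w → Commute (f u) (f w)) (v : V) : lift f h (of Γ v) = f v :=
  PresentedGroup.toGroup.of _

theorem hom_ext {G : Type*} [Group G] {f g : RAAG Γ →* G} (h : ∀ v, f (of Γ v) = g (of Γ v)) :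
    f = g :=
  PresentedGroup.ext h

variable (Γ) in
/-- The subgroup generated by a set of vertices. -/
def special (S : Set V) : Subgroup (RAAG Γ) := Subgroup.closure (of Γ '' S)

theorem of_mem_special {S : Set V} {v : V} (h : v ∈ S) : of Γ v ∈ special Γ S :=
  Subgroup.subset_closure ⟨v, h, rfl⟩

theorem special_mono {S T : Set V} (h : S ⊆ T) : special Γ S ≤ special Γ T :=
  Subgroup.closure_mono (Set.image_mono h)

variable (Γ) in
open Classical in
/-- The retraction onto a special subgroup that kills all other generators. -/
noncomputable def retract (S : Set V) : RAAG Γ →* RAAG Γ :=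
  lift (fun v => if v ∈ S then of Γ v else 1) (by
    intro u w h
    split_ifs
    exacts [commute_of h, Commute.one_right _, Commute.one_left _, Commute.one_left _])

theorem retract_mem (S : Set V) (z : RAAG Γ) : retract Γ S z ∈ special Γ S := by
  classical
  refine PresentedGroup.generated_by (raagRels Γ) ((special Γ S).comap (retract Γ S)) ?_ z
  intro v
  change lift _ _ (of Γ v) ∈ special Γ S
  rw [lift_of]
  split_ifs with h
  exacts [of_mem_special h, one_mem _]

theorem retract_eq_self {S : Set V} {z : RAAG Γ} (hz : z ∈ special Γ S) :
    retract Γ S z = z := by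
  have : special Γ S ≤ (retract Γ S).eqLocus (MonoidHom.id _) := by
    refine (Subgroup.closure_le _).2 ?_
    rintro _ ⟨v, hv, rfl⟩
    change lift _ _ (of Γ v) = of Γ v
    rw [lift_of, if_pos hv]
  exact this hz

theorem retract_comp (S T : Set V) :
    (retract Γ S).comp (retract Γ T) = retract Γ (S ∩ T) := by
  classical
  refine hom_ext fun v => ?_
  simp only [retract, MonoidHom.comp_apply, lift_of]
  by_cases hT : v ∈ T <;> by_cases hS : v ∈ S <;> simp [hT, hS]

theorem special_inter (S T : Set V) : special Γ S ⊓ special Γ T = special Γ (S ∩ T) := by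
  refine le_antisymm ?_
    (le_inf (special_mono Set.inter_subset_left) (special_mono Set.inter_subset_right))
  rintro z ⟨hS, hT⟩
  have : retract Γ (S ∩ T) z = z := by
    rw [← retract_comp, MonoidHom.comp_apply, retract_eq_self hT, retract_eq_self hS]
  rw [← this]
  exact retract_mem _ z

theorem mem_special_biInter {ι : Type*} (s : Finset ι) (S : ι → Set V) {z : RAAG Γ}
    (h : ∀ i ∈ s, z ∈ special Γ (S i)) : z ∈ special Γ (⋂ i ∈ s, S i) := by
  classical
  induction s using Finset.induction_on with
  | empty =>
    have hz := PresentedGroup.generated_by (raagRels Γ) (special Γ Set.univ)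
      (fun v => of_mem_special (Set.mem_univ v)) z
    simpa using hz
  | insert a s _ ih =>
    rw [Finset.set_biInter_insert, ← special_inter]
    exact ⟨h a (Finset.mem_insert_self a s), ih fun i hi => h i (Finset.mem_insert_of_mem hi)⟩

variable (Γ) in
/-- The subgroup generated by the link of a vertex. -/
def link (v : V) : Subgroup (RAAG Γ) := special Γ (Γ.neighborSet v)

/-- Left translation on the free group on the left cosets of `C`. -/
def cosetAut {A : Type*} [Group A] (C : Subgroup A) : A →* MulAut (FreeGroup (A ⧸ C)) where
  toFun a := FreeGroup.freeGroupCongr (MulAction.toPerm a)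
  map_one' := by
    refine MulEquiv.toMonoidHom_injective (FreeGroup.ext_hom _ _ fun q => ?_)
    simp
  map_mul' a b := by
    refine MulEquiv.toMonoidHom_injective (FreeGroup.ext_hom _ _ fun q => ?_)
    simp [mul_smul]

@[simp]
theorem cosetAut_of {A : Type*} [Group A] (C : Subgroup A) (a : A) (q : A ⧸ C) :
    cosetAut C a (FreeGroup.of q) = FreeGroup.of (a • q) := by
  simp [cosetAut]

theorem smul_mk_one {A : Type*} [Group A] {C : Subgroup A} {a : A} (h : a ∈ C) :
    a • (QuotientGroup.mk 1 : A ⧸ C) = (QuotientGroup.mk 1 : A ⧸ C) := by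
  rw [← MulAction.mem_stabilizer_iff, MulAction.stabilizer_quotient]
  exact h

variable (Γ) in
open Classical in
/-- The splitting of a right-angled Artin group along a vertex `v`: a free group on the cosets of
the subgroup generated by the link of `v`, extended by the remaining generators. -/
noncomputable def split (v : V) :
    RAAG Γ →* FreeGroup (RAAG Γ ⧸ link Γ v) ⋊[cosetAut (link Γ v)] RAAG Γ :=
  lift (fun w => if w = v then SemidirectProduct.inl (FreeGroup.of (QuotientGroup.mk 1 : RAAG Γ ⧸ link Γ v))
    else SemidirectProduct.inr (of Γ w)) (by
    have key : ∀ w, Γ.Adj v w → Commute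
        (SemidirectProduct.inl (FreeGroup.of (QuotientGroup.mk 1 : RAAG Γ ⧸ link Γ v)) : _ ⋊[cosetAut (link Γ v)] _)
        (SemidirectProduct.inr (of Γ w)) := by
      intro w hw
      ext
      · simpa using congrArg FreeGroup.of (smul_mk_one (show of Γ w ∈ link Γ v from of_mem_special hw)).symm
      · simp
    intro u w h
    split_ifs with h₁ h₂ h₂
    · exact Commute.refl _
    · exact key w (h₁ ▸ h)
    · exact (key u (h₂ ▸ h.symm)).symm
    · exact (commute_of h).map SemidirectProduct.inr)

/-- The conjugate of a generator by a coset of the subgroup generated by its link. -/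
def cosetConj (v : V) : RAAG Γ ⧸ link Γ v → RAAG Γ :=
  Quotient.lift (fun a => a * of Γ v * a⁻¹) (by
    intro a b hab
    have hmem : a⁻¹ * b ∈ link Γ v := QuotientGroup.leftRel_apply.1 hab
    have hle : link Γ v ≤ Subgroup.centralizer {of Γ v} := by
      refine (Subgroup.closure_le _).2 ?_
      rintro _ ⟨w, hw, rfl⟩
      exact Subgroup.mem_centralizer_singleton_iff.2 (commute_of hw).symm.eq
    obtain ⟨c, rfl⟩ : ∃ c, b = a * c := ⟨a⁻¹ * b, (mul_inv_cancel_left a b).symm⟩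
    rw [inv_mul_cancel_left] at hmem
    have hc := Subgroup.mem_centralizer_singleton_iff.1 (hle hmem)
    rw [mul_assoc a c, hc]
    group)

theorem cosetConj_mk (v : V) (a : RAAG Γ) :
    cosetConj v (a : RAAG Γ ⧸ link Γ v) = a * of Γ v * a⁻¹ := rfl

variable (Γ) in
/-- The left inverse of the splitting along a vertex. -/
def unsplit (v : V) :
    FreeGroup (RAAG Γ ⧸ link Γ v) ⋊[cosetAut (link Γ v)] RAAG Γ →* RAAG Γ :=
  SemidirectProduct.lift (FreeGroup.lift (cosetConj v)) (MonoidHom.id _) (by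
    intro g
    refine FreeGroup.ext_hom _ _ fun q => ?_
    induction q using QuotientGroup.induction_on with
    | H a =>
      change FreeGroup.lift (cosetConj v) (cosetAut _ g (FreeGroup.of _)) =
        g * FreeGroup.lift (cosetConj v) (FreeGroup.of _) * g⁻¹
      rw [cosetAut_of, FreeGroup.lift_apply_of, FreeGroup.lift_apply_of]
      change (g * a) * of Γ v * (g * a)⁻¹ = g * (a * of Γ v * a⁻¹) * g⁻¹
      group)

theorem unsplit_split (v : V) (z : RAAG Γ) : unsplit Γ v (split Γ v z) = z := by
  have : (unsplit Γ v).comp (split Γ v) = MonoidHom.id _ := by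
    classical
    refine hom_ext fun w => ?_
    simp only [split, MonoidHom.comp_apply, lift_of, MonoidHom.id_apply]
    split_ifs with h
    · subst h
      simp [unsplit, cosetConj_mk]
    · simp [unsplit]
  exact DFunLike.congr_fun this z

theorem split_of_self (v : V) :
    split Γ v (of Γ v) = SemidirectProduct.inl (FreeGroup.of (QuotientGroup.mk 1)) := by
  simp [split]

/-- The centralizer of a nontrivial power of a generator is contained in the subgroup generated
by the star of the corresponding vertex. -/
theorem mem_special_star {v : V} {m : ℕ} (hm : m ≠ 0) {z : RAAG Γ}
    (hz : Commute z (of Γ v ^ m)) : z ∈ special Γ (insert v (Γ.neighborSet v)) := by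
  classical
  generalize hf : (split Γ v z).left = f
  generalize hb : (split Γ v z).right = b
  have h1 : f * FreeGroup.of (b • (QuotientGroup.mk 1 : RAAG Γ ⧸ link Γ v)) ^ m =
      FreeGroup.of (QuotientGroup.mk 1 : RAAG Γ ⧸ link Γ v) ^ m * f := by
    have h2 := congrArg SemidirectProduct.left (hz.map (split Γ v)).eq
    rw [map_pow, split_of_self, ← map_pow, SemidirectProduct.mul_left, SemidirectProduct.mul_left,
      SemidirectProduct.left_inl, SemidirectProduct.right_inl, map_one, map_pow, cosetAut_of, hf,
      hb] at h2
    exact h2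
  have hbC : b ∈ link Γ v := by
    let ε : FreeGroup (RAAG Γ ⧸ link Γ v) →* Multiplicative ℤ :=
      FreeGroup.lift fun q => if q = (QuotientGroup.mk 1 : RAAG Γ ⧸ link Γ v) then Multiplicative.ofAdd 1 else 1
    have h3 := congrArg ε h1
    rw [map_mul, map_mul, mul_comm, mul_left_inj, map_pow, map_pow] at h3
    by_contra hne
    have hne' : b • (QuotientGroup.mk 1 : RAAG Γ ⧸ link Γ v) ≠ (QuotientGroup.mk 1 : RAAG Γ ⧸ link Γ v) := by
      rwa [Ne, ← MulAction.mem_stabilizer_iff, MulAction.stabilizer_quotient]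
    simp only [ε, FreeGroup.lift_apply_of, if_neg hne', if_true, one_pow] at h3
    have h4 := congrArg Multiplicative.toAdd h3
    simp at h4
    exact hm (by exact_mod_cast h4.symm)
  rw [smul_mk_one hbC] at h1
  obtain ⟨k, hk⟩ := Subgroup.mem_zpowers_iff.1
    (FreeGroup.mem_zpowers_of_commute_of_pow hm f h1)
  have hz' : z = of Γ v ^ k * b := by
    rw [← unsplit_split v z, ← SemidirectProduct.inl_left_mul_inr_right (split Γ v z), hf, hb,
      ← hk]
    have : cosetConj v (QuotientGroup.mk 1) = of Γ v := by
      rw [cosetConj_mk, one_mul, inv_one, mul_one]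
    simp [unsplit, this]
  rw [hz']
  exact mul_mem (zpow_mem (of_mem_special (Set.mem_insert _ _)) k)
    (special_mono (Set.subset_insert _ _) hbC)

/-- If no vertex is adjacent to all others, then only the identity centralizes a finite-index
subgroup. -/
theorem eq_one_of_commute_finiteIndex [Fintype V] (hΓ : ∀ v, ∃ w, w ≠ v ∧ ¬ Γ.Adj v w)
    (z : RAAG Γ) (K : Subgroup (RAAG Γ)) (hK : K.FiniteIndex) (h : ∀ k ∈ K, Commute z k) :
    z = 1 := by
  have hmem : ∀ v ∈ Finset.univ, z ∈ special Γ (insert v (Γ.neighborSet v)) := by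
    intro v _
    obtain ⟨m, hm, _, hmK⟩ := K.exists_pow_mem_of_index_ne_zero hK.index_ne_zero (of Γ v)
    exact mem_special_star hm.ne' (h _ hmK)
  have hz := mem_special_biInter Finset.univ _ hmem
  have hempty : (⋂ v ∈ (Finset.univ : Finset V), insert v (Γ.neighborSet v)) = ∅ := by
    refine Set.eq_empty_of_forall_notMem fun u hu => ?_
    obtain ⟨w, hwu, hw⟩ := hΓ u
    have := Set.mem_iInter₂.1 hu w (Finset.mem_univ w)
    rcases this with rfl | h
    · exact hwu rfl
    · exact hw h.symm
  rw [hempty, special, Set.image_empty, Subgroup.closure_empty] at hz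
  exact Subgroup.mem_bot.1 hz

/-- Isomorphic graphs have isomorphic right-angled Artin groups. -/
def congr {W : Type*} {Δ : SimpleGraph W} (e : Γ ≃g Δ) : RAAG Γ ≃* RAAG Δ :=
  MonoidHom.toMulEquiv
    (lift (fun v => of Δ (e v)) fun _ _ h => commute_of (e.map_adj_iff.2 h))
    (lift (fun w => of Γ (e.symm w)) fun _ _ h => commute_of (e.symm.map_adj_iff.2 h))
    (hom_ext fun v => by simp)
    (hom_ext fun w => by simp)

variable (Γ) in
/-- The join of a graph with the complete graph on `ι`. -/
def coneJoin (ι : Type*) : SimpleGraph (V ⊕ ι) := (Γᶜ ⊕g (⊥ : SimpleGraph ι))ᶜ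

theorem coneJoin_adj_inl {ι : Type*} {u w : V} :
    (coneJoin Γ ι).Adj (.inl u) (.inl w) ↔ Γ.Adj u w := by
  simp only [coneJoin, SimpleGraph.compl_adj, SimpleGraph.sum_adj_inl]
  grind [Γ.loopless, SimpleGraph.Adj.ne]

theorem coneJoin_adj_inr {ι : Type*} {x : V ⊕ ι} {i : ι} :
    (coneJoin Γ ι).Adj x (.inr i) ↔ x ≠ .inr i := by
  rcases x with u | j <;> simp [coneJoin]

/-- Homomorphisms out of a finite power of `ℤ` given by commuting elements. -/
def powersHom {G ι : Type*} [Group G] [Fintype ι] (g : ι → G)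
    (h : Pairwise fun i j => Commute (g i) (g j)) : (ι → Multiplicative ℤ) →* G :=
  MonoidHom.noncommPiCoprod (fun i => zpowersHom G (g i)) fun _ _ hij _ _ =>
    (h hij).zpow_zpow _ _

@[simp]
theorem powersHom_mulSingle {G ι : Type*} [Group G] [Fintype ι] [DecidableEq ι] (g : ι → G)
    (h : Pairwise fun i j => Commute (g i) (g j)) (i : ι) (x : Multiplicative ℤ) :
    powersHom g h (Pi.mulSingle i x) = g i ^ x.toAdd :=
  MonoidHom.noncommPiCoprod_mulSingle _ _ _

theorem commute_powersHom {G ι : Type*} [Group G] [Fintype ι] (g : ι → G)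
    (h : Pairwise fun i j => Commute (g i) (g j)) {a : G} (ha : ∀ i, Commute a (g i))
    (x : ι → Multiplicative ℤ) : Commute a (powersHom g h x) :=
  MonoidHom.commute_noncommPiCoprod _ (fun i _ => (ha i).zpow_right _) x

section coneJoin

variable (Γ) (ι : Type*)

open Classical in
/-- The map from the right-angled Artin group of a cone to the product with a free abelian
group. -/
noncomputable def ofCone : RAAG (coneJoin Γ ι) →* RAAG Γ × (ι → Multiplicative ℤ) :=
  lift (Sum.elim (fun v => (of Γ v, 1))
    (fun i => (1, Pi.mulSingle i (Multiplicative.ofAdd 1)))) (by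
    rintro (u | i) (w | j) h
    · exact Prod.ext (commute_of (coneJoin_adj_inl.1 h)).eq rfl
    · exact Prod.ext (by simp) (mul_comm _ _)
    · exact Prod.ext (by simp) (mul_comm _ _)
    · exact Prod.ext rfl (mul_comm _ _))

/-- The inclusion of a right-angled Artin group into that of a cone. -/
def baseHom : RAAG Γ →* RAAG (coneJoin Γ ι) :=
  lift (fun v => of (coneJoin Γ ι) (.inl v)) fun _ _ h => commute_of (coneJoin_adj_inl.2 h)

/-- The inclusion of the free abelian group generated by the cone vertices. -/
def apexHom [Fintype ι] : (ι → Multiplicative ℤ) →* RAAG (coneJoin Γ ι) :=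
  powersHom (fun i => of (coneJoin Γ ι) (.inr i)) fun _ _ hij =>
    commute_of (coneJoin_adj_inr.2 (by simpa using hij))

@[simp]
theorem apexHom_mulSingle [Fintype ι] [DecidableEq ι] (i : ι) (x : Multiplicative ℤ) :
    apexHom Γ ι (Pi.mulSingle i x) = of (coneJoin Γ ι) (.inr i) ^ x.toAdd :=
  powersHom_mulSingle _ _ _ _

theorem commute_baseHom_apexHom [Fintype ι] (a : RAAG Γ) (x : ι → Multiplicative ℤ) :
    Commute (baseHom Γ ι a) (apexHom Γ ι x) := by
  refine commute_powersHom _ _ (fun i => ?_) x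
  refine Subgroup.mem_centralizer_singleton_iff.1 (PresentedGroup.generated_by (raagRels Γ)
    ((Subgroup.centralizer {of (coneJoin Γ ι) (.inr i)}).comap (baseHom Γ ι)) (fun v => ?_) a)
  refine Subgroup.mem_centralizer_singleton_iff.2 ?_
  change lift _ _ (of Γ v) * _ = _ * lift _ _ (of Γ v)
  rw [lift_of]
  exact commute_of (coneJoin_adj_inr.2 (by simp))

/-- Coning off corresponds to multiplying by a free abelian group. -/
noncomputable def coneJoinEquiv [Fintype ι] :
    RAAG (coneJoin Γ ι) ≃* RAAG Γ × (ι → Multiplicative ℤ) :=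
  MonoidHom.toMulEquiv (ofCone Γ ι)
    ((baseHom Γ ι).noncommCoprod (apexHom Γ ι) (commute_baseHom_apexHom Γ ι))
    (hom_ext fun x => by rcases x with v | i <;> simp [ofCone, baseHom])
    (by
      classical
      have h₁ : (ofCone Γ ι).comp (baseHom Γ ι) = MonoidHom.inl _ _ :=
        hom_ext fun v => by simp [ofCone, baseHom]
      have h₂ : (ofCone Γ ι).comp (apexHom Γ ι) = MonoidHom.inr _ _ := by
        refine MonoidHom.pi_ext fun i y => ?_
        rw [MonoidHom.comp_apply, apexHom_mulSingle]
        rw [map_zpow, ofCone, lift_of]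
        exact Prod.ext (by simp) (by simp [← Pi.mulSingle_zpow, ← ofAdd_zsmul])
      refine MonoidHom.ext fun ⟨a, x⟩ => ?_
      have h₁' := DFunLike.congr_fun h₁ a
      have h₂' := DFunLike.congr_fun h₂ x
      simp only [MonoidHom.comp_apply] at h₁' h₂'
      simp [h₁', h₂'])

end coneJoin

variable (Γ) in
/-- Every graph is obtained from the subgraph induced on its non-dominating vertices by adding
cone vertices. -/
theorem exists_iso_coneJoin : ∃ S : Set V, Nonempty (Γ ≃g coneJoin (Γ.induce S) (Sᶜ : Set V)) ∧
    ∀ v : S, ∃ w : S, w ≠ v ∧ ¬ (Γ.induce S).Adj v w := by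
  classical
  let S : Set V := {v | ∃ w, w ≠ v ∧ ¬ Γ.Adj v w}
  have hS : ∀ v ∉ S, ∀ w, w ≠ v → Γ.Adj v w := by
    intro v hv w hw
    by_contra h
    exact hv ⟨w, hw, h⟩
  refine ⟨S, ⟨RelIso.symm ⟨Equiv.Set.sumCompl S, ?_⟩⟩, ?_⟩
  · intro x y
    rcases y with w | j
    · rcases x with u | i
      · exact (coneJoin_adj_inl (Γ := Γ.induce S) (u := u) (w := w)).symm
      · rw [SimpleGraph.adj_comm (coneJoin _ _), coneJoin_adj_inr]
        simp only [Equiv.Set.sumCompl_apply_inl, Equiv.Set.sumCompl_apply_inr, ne_eq,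
          reduceCtorEq, not_false_eq_true, iff_true]
        exact hS i i.2 w fun h => i.2 (h ▸ w.2)
    · rw [coneJoin_adj_inr, ← (Equiv.Set.sumCompl S).injective.ne_iff,
        Equiv.Set.sumCompl_apply_inr]
      exact ⟨fun h => h.ne, fun h => (hS j j.2 _ h).symm⟩
  · rintro ⟨v, w, hwv, hw⟩
    exact ⟨⟨w, v, hwv.symm, fun h => hw h.symm⟩, fun h => hwv (congrArg Subtype.val h), hw⟩

end RAAG

/-- If `G` is abstractly commensurable with `G' × ℤⁿ`, then `G` is abstractly
commensurable with a right-angled Artin group if and only if `G'` is. -/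
theorem commensurable_raag_iff_of_commensurable_prod_zn
    (G G' : Type) [Group G] [Group G'] (n : ℕ)
    (h : AbstractlyCommensurable G (G' × Multiplicative (Fin n → ℤ))) :
    (∃ (V : Type) (_ : Fintype V) (Γ : SimpleGraph V),
        AbstractlyCommensurable G (RAAG Γ)) ↔
    (∃ (V : Type) (_ : Fintype V) (Γ : SimpleGraph V),
        AbstractlyCommensurable G' (RAAG Γ)) := by
  classical
  constructor
  · rintro ⟨V, _, Γ, hΓ⟩
    obtain ⟨S, ⟨e⟩, hS⟩ := RAAG.exists_iso_coneJoin Γ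
    have hsplit := AbstractlyCommensurable.of_mulEquiv
      ((RAAG.congr e).trans (RAAG.coneJoinEquiv (Γ.induce S) (Sᶜ : Set V)))
    obtain ⟨j, _, hj⟩ := AbstractlyCommensurable.exists_prod_free_of_prod
      (RAAG.eq_one_of_commute_finiteIndex hS) (hsplit.symm.trans (hΓ.symm.trans h))
    exact ⟨S ⊕ j, inferInstance, RAAG.coneJoin (Γ.induce S) j,
      hj.trans (.of_mulEquiv (RAAG.coneJoinEquiv (Γ.induce S) j).symm)⟩
  · rintro ⟨V, _, Γ, hΓ⟩
    exact ⟨V ⊕ Fin n, inferInstance, RAAG.coneJoin Γ (Fin n),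
      (h.trans (hΓ.prod (.of_mulEquiv (MulEquiv.funMultiplicative (Fin n) ℤ)))).trans
        (.of_mulEquiv (RAAG.coneJoinEquiv Γ (Fin n)).symm)⟩
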